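/- (First unitary moment for a general observable.) Let d ≥ 2, let ρ be a density matrix on ℂ^(Fin d × Fin d), and let M : Matrix (Fin d) (Fin d) ℂ be Hermitian. Then ∫ trace[ρ * (U ⊗ₖ U) * (M ⊗ₖ M) * (U ⊗ₖ U)ᴴ] dμ_U(U) = a₁ + a₂·trace(ρ*S), where a₁ = ((trace M)² − d⁻¹·trace(M*M))/(d² − 1) and a₂ = (trace(M*M) − d⁻¹·(trace M)²)/(d² − 1). -/

import Mathlib

open Matrix MeasureTheory
open scoped Kronecker ComplexOrder

/-- The swap operator `S` on `ℂ^(d·d)`: `S_{(i,j),(k,l)} = 1` iff `i = l` and `j = k`. -/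
def swapOp (d : ℕ) : Matrix (Fin d × Fin d) (Fin d × Fin d) ℂ :=
  Matrix.of fun p q => if p.1 = q.2 ∧ p.2 = q.1 then 1 else 0

noncomputable instance (d : ℕ) : MeasurableSpace (Matrix.unitaryGroup (Fin d) ℂ) := borel _
instance (d : ℕ) : BorelSpace (Matrix.unitaryGroup (Fin d) ℂ) := ⟨rfl⟩

/-- The unitary group is compact: it is closed and its entries are bounded by `1`. -/
theorem isCompact_unitaryGroup {n : Type*} [Fintype n] [DecidableEq n] :
    IsCompact (Matrix.unitaryGroup n ℂ : Set (Matrix n n ℂ)) := by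
  have hc : IsCompact (Set.pi Set.univ fun _ : n => Set.pi Set.univ fun _ : n =>
      Metric.closedBall (0 : ℂ) 1) :=
    isCompact_univ_pi fun _ => isCompact_univ_pi fun _ => isCompact_closedBall _ _
  refine hc.of_isClosed_subset ?_ fun U hU => ?_
  · have : (Matrix.unitaryGroup n ℂ : Set (Matrix n n ℂ)) = {A | A * Aᴴ = 1} := by
      ext A
      exact Matrix.mem_unitaryGroup_iff
    rw [this]
    exact isClosed_eq (continuous_id.matrix_mul continuous_id.matrix_conjTranspose)
      continuous_const
  · simpa [Set.mem_pi] using fun i j => entry_norm_bound_of_unitary hU i j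

/-- Two-sided matrix multiplication commutes with entrywise integration. -/
theorem integral_mul_mul_apply {α l m n o : Type*} [Fintype m] [Fintype n]
    [MeasurableSpace α] {μ : Measure α} (F : α → Matrix m n ℂ)
    (hF : ∀ p q, Integrable (fun x => F x p q) μ) (A : Matrix l m ℂ) (B : Matrix n o ℂ)
    (i : l) (j : o) :
    ∫ x, (A * F x * B) i j ∂μ = (A * (Matrix.of fun p q => ∫ x, F x p q ∂μ) * B) i j := by
  simp only [Matrix.mul_apply, Matrix.of_apply]
  rw [integral_finsetSum _ fun q _ =>
    (integrable_finsetSum _ fun p _ => (hF p q).const_mul _).mul_const _]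
  refine Finset.sum_congr rfl fun q _ => ?_
  rw [integral_mul_const, integral_finsetSum _ fun p _ => (hF p q).const_mul _]
  simp only [integral_const_mul]

/-- Integration commutes with the functional `X ↦ tr (A X)`. -/
theorem integral_trace_mul {α m : Type*} [Fintype m] [DecidableEq m]
    [MeasurableSpace α] {μ : Measure α} (F : α → Matrix m m ℂ)
    (hF : ∀ p q, Integrable (fun x => F x p q) μ) (A : Matrix m m ℂ) :
    ∫ x, (A * F x).trace ∂μ = (A * (Matrix.of fun p q => ∫ x, F x p q ∂μ)).trace := by
  have hAF : ∀ p, Integrable (fun x => (A * F x) p p) μ := fun p => by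
    simpa only [Matrix.mul_apply] using integrable_finsetSum _ fun q _ => (hF q p).const_mul _
  simp only [Matrix.trace, Matrix.diag_apply]
  rw [integral_finsetSum _ fun p _ => hAF p]
  refine Finset.sum_congr rfl fun p _ => ?_
  simpa only [Matrix.mul_one] using integral_mul_mul_apply F hF A 1 p p

section Commutant

variable {d : ℕ} {T : Matrix (Fin d × Fin d) (Fin d × Fin d) ℂ}

/-- Invariance under `V ⊗ V` for diagonal unitaries `V`. -/
theorem phase_mul_apply_eq
    (hT : ∀ V ∈ Matrix.unitaryGroup (Fin d) ℂ, (V ⊗ₖ V) * T * (V ⊗ₖ V)ᴴ = T)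
    (v : Fin d → ℂ) (hv : ∀ i, v i * star (v i) = 1) (i j k l : Fin d) :
    v i * v j * T (i, j) (k, l) * (star (v k) * star (v l)) = T (i, j) (k, l) := by
  have hV : Matrix.diagonal v ∈ Matrix.unitaryGroup (Fin d) ℂ := by
    rw [Matrix.mem_unitaryGroup_iff, Matrix.star_eq_conjTranspose,
      Matrix.diagonal_conjTranspose, Matrix.diagonal_mul_diagonal]
    simp only [Pi.star_apply, hv, Matrix.diagonal_one]
  have h := congrFun (congrFun (hT _ hV) (i, j)) (k, l)
  rw [Matrix.diagonal_kronecker_diagonal, Matrix.diagonal_conjTranspose,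
    Matrix.mul_diagonal, Matrix.diagonal_mul] at h
  simpa [mul_comm, mul_left_comm, mul_assoc] using h

/-- Entries whose row and column indices differ as multisets vanish. -/
theorem apply_eq_zero_of_invariant
    (hT : ∀ V ∈ Matrix.unitaryGroup (Fin d) ℂ, (V ⊗ₖ V) * T * (V ⊗ₖ V)ᴴ = T)
    {i j k l : Fin d} (h₁ : ¬(i = k ∧ j = l)) (h₂ : ¬(i = l ∧ j = k)) :
    T (i, j) (k, l) = 0 := by
  by_contra hne
  have key : ∀ a : Fin d,
      (if i = a then Complex.I else 1) * (if j = a then Complex.I else 1) *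
        (star (if k = a then Complex.I else 1) * star (if l = a then Complex.I else 1)) = 1 :=
    fun a => mul_right_cancel₀ hne <| by
      rw [one_mul]
      refine Eq.trans ?_ (phase_mul_apply_eq hT (fun x => if x = a then Complex.I else 1)
        (fun x => by by_cases h : x = a <;> simp [h]) i j k l)
      ring
  have e₁ := key i
  have e₂ := key j
  rw [eq_comm (a := i) (b := k), eq_comm (a := j) (b := l)] at h₁
  rw [eq_comm (a := i) (b := l), eq_comm (a := j) (b := k)] at h₂
  by_cases hij : j = i
  · subst j
    by_cases hk : k = i <;> by_cases hl : l = i <;>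
      simp [hk, hl, Complex.ext_iff, show (-1 : ℝ) ≠ 1 by norm_num] at e₁ h₁ h₂
  · by_cases hik : k = i <;> by_cases hil : l = i <;> by_cases hjk : k = j <;>
      by_cases hjl : l = j <;>
      simp [hij, Ne.symm hij, hik, hil, hjk, hjl, Complex.ext_iff] at e₁ e₂ h₁ h₂

/-- Invariance under `V ⊗ V` for permutation matrices `V`. -/
theorem apply_perm_of_invariant
    (hT : ∀ V ∈ Matrix.unitaryGroup (Fin d) ℂ, (V ⊗ₖ V) * T * (V ⊗ₖ V)ᴴ = T)
    (σ : Equiv.Perm (Fin d)) (i j k l : Fin d) :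
    T (σ i, σ j) (σ k, σ l) = T (i, j) (k, l) := by
  have hV : (1 : Matrix (Fin d) (Fin d) ℂ).submatrix σ id ∈ Matrix.unitaryGroup (Fin d) ℂ := by
    rw [Matrix.mem_unitaryGroup_iff, Matrix.star_eq_conjTranspose,
      Matrix.conjTranspose_submatrix, Matrix.conjTranspose_one]
    exact (Matrix.submatrix_mul_equiv _ _ σ (Equiv.refl _) σ).trans (by simp)
  have h := congrFun (congrFun (hT _ hV) (i, j)) (k, l)
  rw [← h]
  simp [Matrix.mul_apply, Fintype.sum_prod_type, Matrix.one_apply, apply_ite (starRingEnd ℂ)]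

/-- The reflection in the vector `e_a + 2 e_b` ties the diagonal entry to the other two
orbits. -/
theorem apply_diag_of_invariant
    (hT : ∀ V ∈ Matrix.unitaryGroup (Fin d) ℂ, (V ⊗ₖ V) * T * (V ⊗ₖ V)ᴴ = T)
    {a b : Fin d} (hab : a ≠ b) :
    T (a, a) (a, a) = T (a, b) (a, b) + T (a, b) (b, a) := by
  let w : Fin d → ℂ := Pi.single a 1 + Pi.single b 2
  have hww : w ⬝ᵥ w = 5 := by
    simp [w, hab, hab.symm]
    norm_num
  have hws : star w = w := by
    simp [w]
  let V : Matrix (Fin d) (Fin d) ℂ := 1 - (2 / 5 : ℂ) • Matrix.vecMulVec w w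
  have hVs : Vᴴ = V := by
    simp [V, Matrix.conjTranspose_sub, Matrix.conjTranspose_smul, Matrix.conjTranspose_vecMulVec,
      hws]
  have hV : V ∈ Matrix.unitaryGroup (Fin d) ℂ := by
    rw [Matrix.mem_unitaryGroup_iff, Matrix.star_eq_conjTranspose, hVs]
    simp only [V, sub_mul, mul_sub, one_mul, mul_one, Matrix.smul_mul, Matrix.mul_smul,
      Matrix.vecMulVec_mul_vecMulVec, hww]
    ext x y
    simp
    ring
  have hVa : ∀ x, V a x = (if x = a then 3 / 5 else 0) + (if x = b then -(4 / 5) else 0) := by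
    intro x
    by_cases h1 : x = a
    · subst h1
      simp [V, w, hab, Matrix.vecMulVec_apply]
      norm_num
    · by_cases h2 : x = b
      · subst h2
        simp [V, w, hab, hab.symm, Matrix.vecMulVec_apply]
        norm_num
      · simp [V, w, hab, h1, h2, Ne.symm h1, Matrix.vecMulVec_apply]
  have hVastar : ∀ x, star (V a x) = V a x := fun x => by
    rw [hVa]
    split_ifs <;> simp
  have h := congrFun (congrFun (hT _ hV) (a, a)) (a, a)
  have z := fun i j k l => apply_eq_zero_of_invariant (i := i) (j := j) (k := k) (l := l) hT
  have p := apply_perm_of_invariant hT (Equiv.swap a b)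
  have pa := p a a a a
  have pb := p a b a b
  have pc := p a b b a
  simp only [Matrix.mul_apply, Fintype.sum_prod_type, Matrix.conjTranspose_apply,
    Matrix.kroneckerMap_apply, star_mul', hVastar] at h
  simp only [hVa] at h
  simp [add_mul, mul_add, Finset.sum_add_distrib] at h
  simp [z, hab, hab.symm] at h pa pb pc
  rw [pa, pb, pc] at h
  linear_combination (-625 / 288) * h

/-- A matrix invariant under conjugation by all `V ⊗ V` is a combination of `1` and the swap. -/
theorem exists_eq_smul_one_add_smul_swapOp (hd : 2 ≤ d)
    (hT : ∀ V ∈ Matrix.unitaryGroup (Fin d) ℂ, (V ⊗ₖ V) * T * (V ⊗ₖ V)ᴴ = T) :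
    ∃ β γ : ℂ, T = β • 1 + γ • swapOp d := by
  let a : Fin d := ⟨0, by omega⟩
  let b : Fin d := ⟨1, by omega⟩
  have hab : a ≠ b := by simp [a, b]
  have htrans : ∀ i j : Fin d, i ≠ j → ∃ σ : Equiv.Perm (Fin d), σ a = i ∧ σ b = j := by
    intro i j hij
    have hb : Equiv.swap a i b ≠ i := fun h =>
      hab <| (Equiv.swap a i).injective (by simpa using h.symm)
    refine ⟨(Equiv.swap a i).trans (Equiv.swap (Equiv.swap a i b) j), ?_, by simp⟩
    simp only [Equiv.trans_apply, Equiv.swap_apply_left]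
    exact Equiv.swap_apply_of_ne_of_ne hb.symm hij
  refine ⟨T (a, b) (a, b), T (a, b) (b, a), ?_⟩
  ext ⟨i, j⟩ ⟨k, l⟩
  by_cases h₁ : i = k ∧ j = l
  · obtain ⟨rfl, rfl⟩ := h₁
    by_cases hij : i = j
    · subst hij
      have := apply_perm_of_invariant hT (Equiv.swap a i) a a a a
      simp only [Equiv.swap_apply_left] at this
      simp [this, swapOp, apply_diag_of_invariant hT hab]
    · obtain ⟨σ, rfl, rfl⟩ := htrans i j hij
      simp [apply_perm_of_invariant hT, swapOp, hab]
  · by_cases h₂ : i = l ∧ j = k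
    · obtain ⟨rfl, rfl⟩ := h₂
      have hij : i ≠ j := fun h => h₁ ⟨h, h.symm⟩
      obtain ⟨σ, rfl, rfl⟩ := htrans i j hij
      simp [apply_perm_of_invariant hT, swapOp, hab]
    · rw [apply_eq_zero_of_invariant hT h₁ h₂]
      simp [swapOp, h₁, h₂]

end Commutant

theorem trace_swapOp_mul_kronecker {d : ℕ} (A B : Matrix (Fin d) (Fin d) ℂ) :
    (swapOp d * (A ⊗ₖ B)).trace = (A * B).trace := by
  simp [Matrix.trace, Matrix.mul_apply, Fintype.sum_prod_type, swapOp, ite_and]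
  exact Finset.sum_comm

theorem trace_swapOp (d : ℕ) : (swapOp d).trace = d := by
  simpa using trace_swapOp_mul_kronecker (1 : Matrix (Fin d) (Fin d) ℂ) 1

theorem swapOp_mul_swapOp (d : ℕ) : swapOp d * swapOp d = 1 := by
  ext ⟨i, j⟩ ⟨k, l⟩
  simp [Matrix.mul_apply, Fintype.sum_prod_type, swapOp, ite_and, Matrix.one_apply]

/-- First unitary moment for a general Hermitian observable `M`:
`∫ tr[ρ (U ⊗ₖ U)(M ⊗ₖ M)(U ⊗ₖ U)ᴴ] dμ_U(U) = a₁ + a₂ · tr(ρ S)`, where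
`a₁ = ((tr M)² − d⁻¹ tr(M²))/(d² − 1)` and `a₂ = (tr(M²) − d⁻¹ (tr M)²)/(d² − 1)`. -/
theorem unitary_first_moment_general (d : ℕ) (hd : 2 ≤ d)
    (ρ : Matrix (Fin d × Fin d) (Fin d × Fin d) ℂ) (hρ : ρ.PosSemidef)
    (hρtr : Matrix.trace ρ = 1)
    (M : Matrix (Fin d) (Fin d) ℂ) (hM : M.IsHermitian)
    (μU : Measure (Matrix.unitaryGroup (Fin d) ℂ)) [μU.IsHaarMeasure]
    [IsProbabilityMeasure μU] :
    (∫ U : Matrix.unitaryGroup (Fin d) ℂ,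
        Matrix.trace (ρ *
          (((U : Matrix (Fin d) (Fin d) ℂ) ⊗ₖ (U : Matrix (Fin d) (Fin d) ℂ)) * (M ⊗ₖ M) *
            ((U : Matrix (Fin d) (Fin d) ℂ) ⊗ₖ (U : Matrix (Fin d) (Fin d) ℂ))ᴴ)) ∂μU) =
      ((Matrix.trace M) ^ 2 - (d : ℂ)⁻¹ * Matrix.trace (M * M)) / ((d : ℂ) ^ 2 - 1) +
      ((Matrix.trace (M * M) - (d : ℂ)⁻¹ * (Matrix.trace M) ^ 2) / ((d : ℂ) ^ 2 - 1)) *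
        Matrix.trace (ρ * swapOp d) := by
  have : CompactSpace (Matrix.unitaryGroup (Fin d) ℂ) :=
    isCompact_iff_compactSpace.mp isCompact_unitaryGroup
  let F : Matrix.unitaryGroup (Fin d) ℂ → Matrix (Fin d × Fin d) (Fin d × Fin d) ℂ := fun U =>
    ((U : Matrix (Fin d) (Fin d) ℂ) ⊗ₖ (U : Matrix (Fin d) (Fin d) ℂ)) * (M ⊗ₖ M) *
      ((U : Matrix (Fin d) (Fin d) ℂ) ⊗ₖ (U : Matrix (Fin d) (Fin d) ℂ))ᴴ
  have hFc : Continuous F := by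
    have hk : Continuous fun U : Matrix.unitaryGroup (Fin d) ℂ =>
        (U : Matrix (Fin d) (Fin d) ℂ) ⊗ₖ (U : Matrix (Fin d) (Fin d) ℂ) :=
      continuous_matrix fun p q =>
        (continuous_subtype_val.matrix_elem p.1 q.1).mul
          (continuous_subtype_val.matrix_elem p.2 q.2)
    exact (hk.matrix_mul continuous_const).matrix_mul hk.matrix_conjTranspose
  have hF : ∀ p q, Integrable (fun U => F U p q) μU := fun p q =>
    (hFc.matrix_elem p q).integrable_of_hasCompactSupport (HasCompactSupport.of_compactSpace _)
  have hFeq : ∀ U, F U =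
      ((U : Matrix (Fin d) (Fin d) ℂ) * M * (U : Matrix (Fin d) (Fin d) ℂ)ᴴ) ⊗ₖ
      ((U : Matrix (Fin d) (Fin d) ℂ) * M * (U : Matrix (Fin d) (Fin d) ℂ)ᴴ) := fun U => by
    simp only [F, Matrix.conjTranspose_kronecker, Matrix.mul_kronecker_mul]
  have hUU : ∀ U : Matrix.unitaryGroup (Fin d) ℂ,
      (U : Matrix (Fin d) (Fin d) ℂ)ᴴ * (U : Matrix (Fin d) (Fin d) ℂ) = 1 := fun U =>
    Matrix.mem_unitaryGroup_iff'.mp U.2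
  have hconj : ∀ (U : Matrix.unitaryGroup (Fin d) ℂ) (N : Matrix (Fin d) (Fin d) ℂ),
      ((U : Matrix (Fin d) (Fin d) ℂ) * N * (U : Matrix (Fin d) (Fin d) ℂ)ᴴ).trace = N.trace :=
    fun U N => by rw [Matrix.trace_mul_comm, ← Matrix.mul_assoc, hUU, Matrix.one_mul]
  let T : Matrix (Fin d × Fin d) (Fin d × Fin d) ℂ := Matrix.of fun p q => ∫ U, F U p q ∂μU
  have hT : ∀ V ∈ Matrix.unitaryGroup (Fin d) ℂ, (V ⊗ₖ V) * T * (V ⊗ₖ V)ᴴ = T := by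
    intro V hV
    ext p q
    rw [← integral_mul_mul_apply F hF]
    refine Eq.trans ?_ (integral_mul_left_eq_self (fun U => F U p q) ⟨V, hV⟩)
    congr 1
    funext U
    simp only [F, Submonoid.coe_mul, Matrix.mul_kronecker_mul, Matrix.conjTranspose_mul,
      Matrix.mul_assoc]
  obtain ⟨β, γ, hβγ⟩ := exists_eq_smul_one_add_smul_swapOp hd hT
  have h₁ : M.trace ^ 2 = T.trace := by
    have h := integral_trace_mul F hF 1
    simp only [Matrix.one_mul, hFeq, Matrix.trace_kronecker, hconj, integral_const,
      probReal_univ, one_smul] at h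
    rw [pow_two, h]
    simp only [T, hFeq]
  have h₂ : (M * M).trace = (swapOp d * T).trace := by
    have hsq : ∀ U : Matrix.unitaryGroup (Fin d) ℂ, (swapOp d * F U).trace = (M * M).trace :=
      fun U => by
        rw [hFeq, trace_swapOp_mul_kronecker, ← hconj U (M * M)]
        congr 1
        simp only [Matrix.mul_assoc]
        rw [← Matrix.mul_assoc _ᴴ, hUU, Matrix.one_mul]
    have h := integral_trace_mul F hF (swapOp d)
    simpa only [hsq, integral_const, probReal_univ, one_smul] using h
  rw [hβγ] at h₁ h₂
  simp only [Matrix.mul_add, Matrix.mul_smul, Matrix.mul_one, swapOp_mul_swapOp, Matrix.trace_add,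
    Matrix.trace_smul, trace_swapOp, Matrix.trace_one, Fintype.card_prod, Fintype.card_fin,
    smul_eq_mul, Nat.cast_mul] at h₁ h₂
  refine (integral_trace_mul F hF ρ).trans ?_
  change (ρ * T).trace = _
  rw [hβγ, h₁, h₂]
  simp only [Matrix.mul_add, Matrix.mul_smul, Matrix.mul_one, Matrix.trace_add,
    Matrix.trace_smul, hρtr, smul_eq_mul]
  have hd0 : (d : ℂ) ≠ 0 := by
    exact_mod_cast (by omega : d ≠ 0)
  have hd1 : (d : ℂ) ^ 2 - 1 ≠ 0 := by
    rw [sub_ne_zero]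
    exact_mod_cast (by nlinarith : d ^ 2 ≠ 1)
  field_simp
  ring
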